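/- Let p be a prime and let f : ℙ¹_{ℤ_p} → ℙ¹_{ℤ_p} be a finite surjective morphism over ℤ_p. Then there is a non-negative integer N such that if a, b ∈ ℙ¹(ℤ_p) satisfy f^{n}(a) = f^{n}(b) for some n ≥ 0, then f^{N}(a) = f^{N}(b). -/

import Mathlib

/-!
STATEMENT 8: Let `p` be a prime and `f : ℙ¹_{ℤ_p} → ℙ¹_{ℤ_p}` a finite surjective morphism
over `ℤ_p`.  Then there is `N ≥ 0` such that if `a, b ∈ ℙ¹(ℤ_p)` satisfy `fⁿ(a) = fⁿ(b)` for
some `n ≥ 0`, then `f^N(a) = f^N(b)`.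

Formalization notes.  `ℙ¹_{ℤ_p}` is encoded as `ℙ¹_ℤ ×_{Spec ℤ} Spec ℤ_p` with structure
morphism the second projection; `ℙ¹(ℤ_p)` is the set of sections `Spec ℤ_p ⟶ ℙ¹_{ℤ_p}` of the
structure morphism.
-/

open AlgebraicGeometry CategoryTheory CategoryTheory.Limits

attribute [local instance] MvPolynomial.gradedAlgebra

noncomputable section

/-- Projective `n`-space over `ℤ`, as `Proj` of the graded polynomial ring. -/
def ProjZ (n : ℕ) : Scheme :=
  AlgebraicGeometry.Proj (MvPolynomial.homogeneousSubmodule (Fin (n + 1)) ℤ)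

/-- Projective `n`-space over a commutative ring `R`. -/
def ProjOver (n : ℕ) (R : Type) [CommRing R] : Scheme :=
  Limits.prod (ProjZ n) (Spec (CommRingCat.of R))

/-- The structure morphism of `ℙⁿ_R` over `Spec R`. -/
def ProjOver.structMap (n : ℕ) (R : Type) [CommRing R] :
    ProjOver n R ⟶ Spec (CommRingCat.of R) :=
  Limits.prod.snd

/-- The `s`-th iterate of a self-morphism of a scheme. -/
def Scheme.iter {X : Scheme} (f : X ⟶ X) : ℕ → (X ⟶ X)
  | 0 => 𝟙 X
  | s + 1 => Scheme.iter f s ≫ f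


/-- Iterates of a self-map of a finite type: some positive iterate is idempotent. -/
lemma exists_iterate_idempotent {α : Type*} [Finite α] (φ : α → α) :
    ∃ m, 0 < m ∧ ∀ k, 0 < k → φ^[m * k] = φ^[m] := by
  obtain ⟨a, b, hab, h⟩ : ∃ a b, a < b ∧ φ^[a] = φ^[b] := by
    obtain ⟨a, b, hne, h⟩ := Finite.exists_ne_map_eq_of_infinite (fun n : ℕ => φ^[n])
    rcases lt_or_gt_of_ne hne with h' | h'
    exacts [⟨a, b, h', h⟩, ⟨b, a, h', h.symm⟩]
  obtain ⟨d, rfl⟩ := Nat.exists_eq_add_of_lt hab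
  have h1 : ∀ j, φ^[a + j + (d + 1)] = φ^[a + j] := fun j => by
    rw [show a + j + (d + 1) = j + (a + d + 1) by ring, Function.iterate_add, ← h,
      ← Function.iterate_add, add_comm]
  have h2 : ∀ i j, φ^[a + j + i * (d + 1)] = φ^[a + j] := by
    intro i j
    induction i with
    | zero => simp
    | succ i ih =>
      rw [show a + j + (i + 1) * (d + 1) = a + (j + i * (d + 1)) + (d + 1) by ring, h1, ← ih]
      congr 1; ring
  refine ⟨(a + 1) * (d + 1), by positivity, fun k hk => ?_⟩
  obtain ⟨k, rfl⟩ := Nat.exists_eq_succ_of_ne_zero hk.ne'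
  have := h2 ((a + 1) * k) ((a + 1) * (d + 1) - a)
  have hle : a ≤ (a + 1) * (d + 1) := by nlinarith
  rw [show a + ((a + 1) * (d + 1) - a) = (a + 1) * (d + 1) by omega] at this
  rw [← this]
  congr 1; simp only [Nat.succ_eq_add_one]; ring

lemma exists_bound_iterate_eq {α : Type*} [Finite α] (φ : α → α) (c : α) (hc : φ c = c) :
    ∃ m, ∀ n x, φ^[n] x = c → φ^[m] x = c := by
  obtain ⟨m, hm, h⟩ := exists_iterate_idempotent φ
  refine ⟨m, fun n x hx => ?_⟩
  have h1 : φ^[m * (n + 1)] x = c := by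
    rw [show m * (n + 1) = (m * (n + 1) - n) + n by
      have : n ≤ m * (n + 1) := by nlinarith
      omega, Function.iterate_add_apply, hx, Function.iterate_fixed hc]
  rwa [h _ n.succ_pos] at h1

section SuperAttracting

variable {p : ℕ} [Fact p.Prime]

/-- Eventual injectivity for a contracting germ `x ↦ x ^ e * V x` on `pℤ_p`. -/
lemma contracting_germ_cancellation (e : ℕ) (he : e ≠ 0) (V G : ℤ_[p] → ℤ_[p])
    (hV : ∀ x y, (p : ℤ_[p]) ∣ x → (p : ℤ_[p]) ∣ y → x - y ∣ V x - V y) (hV0 : V 0 ≠ 0)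
    (hG : ∀ x, (p : ℤ_[p]) ∣ x → G x = x ^ e * V x)
    (hc : ∀ x, (p : ℤ_[p]) ∣ x → (p : ℤ_[p]) * x ∣ G x) :
    ∃ N, ∀ n x y, (p : ℤ_[p]) ∣ x → (p : ℤ_[p]) ∣ y → G^[n] x = G^[n] y →
      G^[N] x = G^[N] y := by
  have hp : (p : ℤ_[p]) ≠ 0 := by exact_mod_cast (Fact.out : p.Prime).ne_zero
  obtain ⟨s, hs⟩ : ∃ s : ℕ, ¬ ((p : ℤ_[p]) ^ s ∣ (e : ℤ_[p])) := by
    refine ⟨e, fun h => ?_⟩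
    have h2 : (p ^ e : ℤ) ∣ (e : ℤ) := (PadicInt.pow_p_dvd_int_iff e e).1 (by exact_mod_cast h)
    have h3 := Nat.le_of_dvd (Nat.pos_of_ne_zero he) (by exact_mod_cast h2 : p ^ e ∣ e)
    exact absurd h3 (not_le.2 (Nat.lt_pow_self (Fact.out : p.Prime).one_lt))
  set M : ℤ_[p] := (p : ℤ_[p]) ^ s * (p * V 0) with hM
  have hpM : (p : ℤ_[p]) ∣ M := ⟨(p : ℤ_[p]) ^ s * V 0, by rw [hM]; ring⟩
  have hpD : ∀ {x}, M ∣ x → (p : ℤ_[p]) ∣ x := fun h => hpM.trans h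
  obtain ⟨L, hL⟩ : ∃ L, M ∣ (p : ℤ_[p]) ^ L := by
    refine ⟨s + (1 + (V 0).valuation), ?_⟩
    rw [hM, pow_add, pow_add, pow_one]
    refine mul_dvd_mul_left _ (mul_dvd_mul_left _ ?_)
    refine ⟨((PadicInt.unitCoeff hV0)⁻¹ : ℤ_[p]ˣ), ?_⟩
    have := PadicInt.unitCoeff_spec hV0
    calc (p : ℤ_[p]) ^ (V 0).valuation
        = (PadicInt.unitCoeff hV0 * (p : ℤ_[p]) ^ (V 0).valuation) *
          ((PadicInt.unitCoeff hV0)⁻¹ : ℤ_[p]ˣ) := by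
          rw [mul_right_comm, Units.mul_inv, one_mul]
      _ = _ := by rw [← this]
  have hGM : ∀ x, M ∣ x → M ∣ G x := fun x hx =>
    hx.trans ((dvd_mul_left _ _).trans (hc x (hpD hx)))
  have hGL : ∀ n x, (p : ℤ_[p]) ∣ x → (p : ℤ_[p]) ∣ G^[n] x ∧ (p : ℤ_[p]) ^ n ∣ G^[n] x := by
    intro n x hx
    induction n with
    | zero => simpa using hx
    | succ n ih =>
      rw [Function.iterate_succ_apply']
      exact ⟨(dvd_mul_right _ _).trans (hc _ ih.1), by
        rw [pow_succ']; exact (mul_dvd_mul_left _ ih.2).trans (hc _ ih.1)⟩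
  -- `V x = V 0 * (1 + p ^ s * p * k)` for `x` close to `0`
  have hVw : ∀ x, M ∣ x → ∃ w : ℤ_[p], IsUnit w ∧ (p : ℤ_[p]) ^ s ∣ w - 1 ∧ V x = V 0 * w := by
    intro x hx
    obtain ⟨k, hk⟩ := hx.trans (by simpa using hV x 0 (hpD hx) (dvd_zero _))
    refine ⟨1 + p * (p ^ s * k), ?_, ⟨p * k, by ring⟩, ?_⟩
    · refine PadicInt.isUnit_iff.2 ?_
      by_contra hne
      have h1 : (p : ℤ_[p]) ∣ 1 + p * (p ^ s * k) :=
        (PadicInt.norm_lt_one_iff_dvd _).1 (lt_of_le_of_ne (PadicInt.norm_le_one _) hne)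
      have h2 : (p : ℤ_[p]) ∣ 1 := (dvd_add_left (dvd_mul_right _ _)).1 h1
      exact PadicInt.prime_p.not_isUnit (isUnit_of_dvd_one h2)
    · rw [sub_eq_iff_eq_add] at hk
      rw [hk, hM]; ring
  have hVne : ∀ x, M ∣ x → V x ≠ 0 := by
    intro x hx
    obtain ⟨w, hw, -, h⟩ := hVw x hx
    rw [h]; exact mul_ne_zero hV0 hw.ne_zero
  have hG0 : ∀ n x, M ∣ x → x ≠ 0 → G^[n] x ≠ 0 ∧ M ∣ G^[n] x := by
    intro n x hx h0
    induction n with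
    | zero => exact ⟨h0, hx⟩
    | succ n ih =>
      rw [Function.iterate_succ_apply']
      refine ⟨?_, hGM _ ih.2⟩
      rw [hG _ (hpD ih.2)]
      exact mul_ne_zero (pow_ne_zero _ ih.1) (hVne _ ih.2)
  let φ : ZMod (p ^ s) → ZMod (p ^ s) := fun r => r ^ e
  have hstep : ∀ r x y, M ∣ x → M ∣ y → x = r * y →
      ∃ r', G x = r' * G y ∧ PadicInt.toZModPow s r' = φ (PadicInt.toZModPow s r) := by
    intro r x y hx hy hr
    obtain ⟨w, -, hw1, hw⟩ := hVw x hx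
    obtain ⟨w', hw'u, hw'1, hw'⟩ := hVw y hy
    have key : ∀ a : ℤ_[p], (p : ℤ_[p]) ^ s ∣ a - 1 → PadicInt.toZModPow s a = 1 := by
      intro a ha
      rw [← sub_eq_zero, ← map_one (PadicInt.toZModPow s), ← map_sub, ← RingHom.mem_ker,
        PadicInt.ker_toZModPow]
      exact Ideal.mem_span_singleton.2 ha
    obtain ⟨u, rfl⟩ := hw'u
    have hu := key _ hw'1
    have hu' : PadicInt.toZModPow s ((u⁻¹ : ℤ_[p]ˣ) : ℤ_[p]) = 1 := by
      have : PadicInt.toZModPow s (((u⁻¹ : ℤ_[p]ˣ) : ℤ_[p]) * (u : ℤ_[p])) = 1 := by simp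
      rwa [map_mul, hu, mul_one] at this
    refine ⟨r ^ e * (w * (u⁻¹ : ℤ_[p]ˣ)), ?_, ?_⟩
    · rw [hG x (hpD hx), hG y (hpD hy), hw, hw', hr, mul_pow]
      calc _ = r ^ e * y ^ e * (V 0 * w) * (((u⁻¹ : ℤ_[p]ˣ) : ℤ_[p]) * (u : ℤ_[p])) := by simp
        _ = _ := by ring
    · simp [map_mul, hu', key _ hw1, φ]
  have hiter : ∀ n r x y, M ∣ x → M ∣ y → y ≠ 0 → x = r * y → ∃ r', G^[n] x = r' * G^[n] y ∧
      PadicInt.toZModPow s r' = φ^[n] (PadicInt.toZModPow s r) := by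
    intro n
    induction n with
    | zero => intro r x y _ _ _ h; exact ⟨r, h, rfl⟩
    | succ n ih =>
      intro r x y hx hy hy0 h
      obtain ⟨r', h1, h2⟩ := hstep r x y hx hy h
      obtain ⟨r'', h3, h4⟩ := ih r' _ _ (hGM x hx) (hGM y hy) (hG0 1 y hy hy0).1 h1
      exact ⟨r'', h3, by rw [h4, h2]; rfl⟩
  have hcong : ∀ r : ℤ_[p], PadicInt.toZModPow s r = 1 → (p : ℤ_[p]) ^ s ∣ r - 1 := by
    intro r hr
    rw [← Ideal.mem_span_singleton, ← PadicInt.ker_toZModPow, RingHom.mem_ker, map_sub, hr,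
      map_one, sub_self]
  have hinj : ∀ r x y, M ∣ x → M ∣ y → y ≠ 0 → x = r * y → PadicInt.toZModPow s r = 1 →
      G x = G y → x = y := by
    intro r x y hx hy hy0 hr hr1 hxy
    obtain ⟨ε, hε⟩ := hcong r hr1
    obtain ⟨w, hwu, hw1, hw⟩ := hVw y hy
    obtain ⟨k, hk⟩ := hV x y (hpD hx) (hpD hy)
    obtain ⟨c, hc⟩ := hy
    obtain ⟨j, hj⟩ : ∃ j, r ^ e = 1 + e * (r - 1) + j * (r - 1) ^ 2 := by
      have := Polynomial.powAddExpansion 1 (r - 1) e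
      obtain ⟨j, hj⟩ := this
      exact ⟨j, by simpa using hj⟩
    rw [hG x (hpD hx), hG y (hpD ⟨c, hc⟩)] at hxy
    have h1 : r ^ e * V x = V y := by
      refine mul_left_cancel₀ (pow_ne_zero e hy0) ?_
      rw [← hxy, hr, mul_pow]; ring
    have hVx : V x = V y + (r - 1) * y * k := by
      rw [sub_eq_iff_eq_add] at hk; rw [hk, hr]; ring
    have h2 : (r - 1) * (V 0 * ((e + j * (r - 1)) * w + r ^ e * ((p : ℤ_[p]) ^ s * p * c) * k))
        = 0 := by
      have h3 : (r ^ e - 1) * V y + r ^ e * (r - 1) * y * k = 0 := by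
        rw [hVx] at h1; linear_combination h1
      have hy' : y = V 0 * ((p : ℤ_[p]) ^ s * p * c) := by rw [hc, hM]; ring
      rw [hw, hy'] at h3
      linear_combination h3 - V 0 * w * hj
    rcases mul_eq_zero.1 h2 with h3 | h3
    · rw [hr, sub_eq_zero.1 h3, one_mul]
    · exfalso
      have h4 := (mul_eq_zero.1 h3).resolve_left hV0
      apply hs
      rw [← hwu.dvd_mul_right]
      refine ⟨-(j * ε * w + r ^ e * (p * c) * k), ?_⟩
      rw [hε] at h4
      linear_combination h4
  have hφ1 : φ 1 = 1 := one_pow e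
  have hdesc : ∀ n r x y, M ∣ x → M ∣ y → y ≠ 0 → x = r * y → PadicInt.toZModPow s r = 1 →
      G^[n] x = G^[n] y → x = y := by
    intro n
    induction n with
    | zero => intro r x y _ _ _ _ _ h; exact h
    | succ n ih =>
      intro r x y hx hy hy0 hr hr1 hxy
      obtain ⟨r', h1, h2⟩ := hstep r x y hx hy hr
      rw [hr1, hφ1] at h2
      exact hinj r x y hx hy hy0 hr hr1
        (ih r' _ _ (hGM x hx) (hGM y hy) (hG0 1 y hy hy0).1 h1 h2 hxy)
  have : NeZero (p ^ s) := ⟨pow_ne_zero _ (Fact.out : p.Prime).ne_zero⟩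
  obtain ⟨m, hm⟩ := exists_bound_iterate_eq φ 1 hφ1
  have hG00 : G 0 = 0 := by rw [hG 0 (dvd_zero _), zero_pow he, zero_mul]
  have hnear : ∀ n x y, M ∣ x → M ∣ y → y ∣ x → G^[n] x = G^[n] y → G^[m] x = G^[m] y := by
    rintro n x y hx hy ⟨r, hr⟩ hxy
    by_cases hy0 : y = 0
    · rw [hr, hy0, zero_mul]
    rw [mul_comm] at hr
    rcases le_total n m with hnm | hnm
    · obtain ⟨k, rfl⟩ := Nat.exists_eq_add_of_le' hnm
      rw [Function.iterate_add_apply, hxy, ← Function.iterate_add_apply]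
    obtain ⟨r₁, h1, h1'⟩ := hiter n r x y hx hy hy0 hr
    obtain ⟨r₂, h2, h2'⟩ := hiter m r x y hx hy hy0 hr
    have hr₁ : r₁ = 1 := by
      rw [hxy] at h1
      exact mul_right_cancel₀ (hG0 n y hy hy0).1 (by rw [← h1, one_mul])
    rw [hr₁, map_one] at h1'
    rw [hm n _ h1'.symm] at h2'
    obtain ⟨k, rfl⟩ := Nat.exists_eq_add_of_le' hnm
    refine hdesc k r₂ _ _ ?_ (hG0 m y hy hy0).2 (hG0 m y hy hy0).1 h2 h2' ?_
    · rw [h2]; exact (hG0 m y hy hy0).2.mul_left _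
    · rwa [← Function.iterate_add_apply, ← Function.iterate_add_apply]
  refine ⟨m + L, fun n x y hx hy hxy => ?_⟩
  have hxL : M ∣ G^[L] x := hL.trans (hGL L x hx).2
  have hyL : M ∣ G^[L] y := hL.trans (hGL L y hy).2
  have hxy' : G^[n] (G^[L] x) = G^[n] (G^[L] y) := by
    rw [← Function.iterate_add_apply, ← Function.iterate_add_apply, add_comm,
      Function.iterate_add_apply, hxy, ← Function.iterate_add_apply]
  rw [Function.iterate_add_apply, Function.iterate_add_apply]
  rcases ValuationRing.dvd_total (G^[L] y) (G^[L] x) with h | h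
  · exact hnear n _ _ hxL hyL h hxy'
  · exact (hnear n _ _ hyL hxL h hxy'.symm).symm

open Polynomial in
/-- Uniform cancellation for a rational function `Q / S` with good denominator on a residue disc
that it maps to itself. -/
lemma rational_disc_cancellation (Q S : ℤ_[p][X]) (t₀ : ℤ_[p]) (G : ℤ_[p] → ℤ_[p])
    (hS : ∀ t, (p : ℤ_[p]) ∣ t - t₀ → IsUnit (S.eval t))
    (hG : ∀ t, (p : ℤ_[p]) ∣ t - t₀ → (p : ℤ_[p]) ∣ G t - t₀ ∧ G t * S.eval t = Q.eval t)
    (hQ : ∀ z, Q ≠ C z * S) :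
    ∃ N, ∀ n x y, (p : ℤ_[p]) ∣ x - t₀ → (p : ℤ_[p]) ∣ y - t₀ → G^[n] x = G^[n] y →
      G^[N] x = G^[N] y := by
  have hGn : ∀ n t, (p : ℤ_[p]) ∣ t - t₀ → (p : ℤ_[p]) ∣ G^[n] t - t₀ := by
    intro n t ht
    induction n with
    | zero => exact ht
    | succ n ih => rw [Function.iterate_succ_apply']; exact (hG _ ih).1
  have hunit : ∀ a : ℤ_[p], ¬ (p : ℤ_[p]) ∣ a → IsUnit a := fun a ha =>
    PadicInt.isUnit_iff.2 (by_contra fun h => ha ((PadicInt.norm_lt_one_iff_dvd _).1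
      (lt_of_le_of_ne (PadicInt.norm_le_one _) h)))
  have hnunit : ∀ a : ℤ_[p], (p : ℤ_[p]) ∣ a → ¬ IsUnit a := fun a ha h =>
    PadicInt.prime_p.not_isUnit (isUnit_of_dvd_unit ha h)
  have hev : ∀ (P : ℤ_[p][X]) (x y : ℤ_[p]), (p : ℤ_[p]) ∣ x - t₀ → (p : ℤ_[p]) ∣ y - t₀ →
      (p : ℤ_[p]) ∣ P.eval x - P.eval y := fun P x y hx hy =>
    (by simpa using dvd_sub hx hy : (p : ℤ_[p]) ∣ x - y).trans (sub_dvd_eval_sub x y P)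
  have ht₀ : (p : ℤ_[p]) ∣ t₀ - t₀ := by simp
  set D : ℤ_[p][X] := derivative Q * S - Q * derivative S with hD
  by_cases hDu : (p : ℤ_[p]) ∣ D.eval t₀
  swap
  · -- the derivative is a unit, so `Q / S` is injective on the disc
    have hinj : ∀ x y, (p : ℤ_[p]) ∣ x - t₀ → (p : ℤ_[p]) ∣ y - t₀ → G x = G y → x = y := by
      intro x y hx hy hxy
      have h1 : Q.eval x * S.eval y - Q.eval y * S.eval x = 0 := by
        rw [← (hG x hx).2, ← (hG y hy).2, hxy]; ring
      obtain ⟨k, hk⟩ := Q.binomExpansion y (x - y)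
      obtain ⟨l, hl⟩ := S.binomExpansion y (x - y)
      rw [add_sub_cancel] at hk hl
      have h2 : (x - y) * (D.eval y + (x - y) * (k * S.eval y - l * Q.eval y)) = 0 := by
        simp only [hD, eval_sub, eval_mul]
        rw [hk, hl] at h1
        linear_combination h1
      refine sub_eq_zero.1 ((mul_eq_zero.1 h2).resolve_right fun h3 => hDu ?_)
      have h4 : (p : ℤ_[p]) ∣ x - y := by simpa using dvd_sub hx hy
      have h5 : (p : ℤ_[p]) ∣ D.eval y :=
        (dvd_add_left (h4.mul_right _)).1 (h3 ▸ dvd_zero _)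
      simpa using dvd_sub h5 (hev D y t₀ hy ht₀)
    refine ⟨0, fun n => ?_⟩
    induction n with
    | zero => exact fun x y _ _ h => h
    | succ n ih =>
      intro x y hx hy hxy
      exact hinj x y hx hy (ih _ _ (hG x hx).1 (hG y hy).1 hxy)
  obtain ⟨z, hz, hzt⟩ : ∃ z, Q.eval z = z * S.eval z ∧ (p : ℤ_[p]) ∣ z - t₀ := by
    have h1 : (p : ℤ_[p]) ∣ (Q - X * S).eval t₀ := by
      have : (Q - X * S).eval t₀ = (G t₀ - t₀) * S.eval t₀ := by
        rw [sub_mul, (hG t₀ ht₀).2]; simp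
      rw [this]; exact (hG t₀ ht₀).1.mul_right _
    have h2 : ‖(derivative (Q - X * S)).eval t₀‖ = 1 := by
      refine PadicInt.isUnit_iff.1 (hunit _ fun h => hnunit (S.eval t₀ ^ 2) ?_ ((hS t₀ ht₀).pow 2))
      have h3 : S.eval t₀ ^ 2 = D.eval t₀ + (G t₀ - t₀) * ((derivative S).eval t₀ * S.eval t₀)
          - (derivative (Q - X * S)).eval t₀ * S.eval t₀ := by
        have := (hG t₀ ht₀).2
        simp only [hD, derivative_sub, derivative_mul, derivative_X, eval_sub, eval_add, eval_mul,
          eval_X, one_mul]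
        linear_combination (- (derivative S).eval t₀) * this
      rw [h3]
      exact dvd_sub (dvd_add hDu ((hG t₀ ht₀).1.mul_right _)) (h.mul_right _)
    obtain ⟨z, hz, hzt, -⟩ := hensels_lemma (F := Q - X * S) (a := t₀) (by
      simp only [coe_aeval_eq_eval]
      rw [h2, one_pow]
      exact (PadicInt.norm_lt_one_iff_dvd _).2 h1)
    simp only [coe_aeval_eq_eval] at hz hzt
    rw [h2] at hzt
    refine ⟨z, ?_, (PadicInt.norm_lt_one_iff_dvd _).1 hzt⟩
    simpa [sub_eq_zero] using hz
  set A : ℤ_[p][X] := Q - C z * S with hA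
  have hA0 : A ≠ 0 := sub_ne_zero.2 (hQ z)
  have hAz : A.eval z = 0 := by simp [hA, hz]
  obtain ⟨W, hW, hWz⟩ := exists_eq_pow_rootMultiplicity_mul_and_not_dvd A hA0 z
  have he : A.rootMultiplicity z ≠ 0 := ((rootMultiplicity_pos hA0).2 hAz).ne'
  set e := A.rootMultiplicity z
  rw [dvd_iff_isRoot] at hWz
  have hzD : ∀ h, (p : ℤ_[p]) ∣ h → (p : ℤ_[p]) ∣ (z + h) - t₀ := fun h hh => by
    rw [add_sub_right_comm]; exact dvd_add hzt hh
  have hSi : ∀ h, (p : ℤ_[p]) ∣ h → S.eval (z + h) * Ring.inverse (S.eval (z + h)) = 1 :=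
    fun h hh => Ring.mul_inverse_cancel _ (hS _ (hzD h hh))
  have hGA : ∀ h, (p : ℤ_[p]) ∣ h → (G (z + h) - z) * S.eval (z + h) = A.eval (z + h) := by
    intro h hh
    rw [sub_mul, (hG _ (hzD h hh)).2]; simp [hA]
  obtain ⟨N, hN⟩ := contracting_germ_cancellation (p := p) e he
    (fun h => W.eval (z + h) * Ring.inverse (S.eval (z + h))) (fun h => G (z + h) - z)
    (by
      intro x y hx hy
      have h1 : x - y ∣ W.eval (z + x) - W.eval (z + y) := by
        simpa using sub_dvd_eval_sub (z + x) (z + y) W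
      have h2 : x - y ∣ S.eval (z + x) - S.eval (z + y) := by
        simpa using sub_dvd_eval_sub (z + x) (z + y) S
      have h3 : W.eval (z + x) * Ring.inverse (S.eval (z + x))
          - W.eval (z + y) * Ring.inverse (S.eval (z + y)) =
          ((W.eval (z + x) - W.eval (z + y)) * S.eval (z + y)
            - W.eval (z + y) * (S.eval (z + x) - S.eval (z + y))) *
            (Ring.inverse (S.eval (z + x)) * Ring.inverse (S.eval (z + y))) := by
        linear_combination (-W.eval (z + x) * Ring.inverse (S.eval (z + x))) * hSi y hy +
          (W.eval (z + y) * Ring.inverse (S.eval (z + y))) * hSi x hx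
      simp only [h3]
      exact (dvd_sub (h1.mul_right _) (h2.mul_left _)).mul_right _)
    (by
      have h0 := hSi 0 (dvd_zero _)
      simp only [add_zero] at h0 ⊢
      exact mul_ne_zero hWz (right_ne_zero_of_mul_eq_one h0))
    (by
      intro x hx
      have h1 := hGA x hx
      rw [hW] at h1
      simp only [eval_mul, eval_pow, eval_sub, eval_X, eval_C, add_sub_cancel_left] at h1
      linear_combination Ring.inverse (S.eval (z + x)) * h1 - (G (z + x) - z) * hSi x hx)
    (by
      intro x hx
      have hdA : (p : ℤ_[p]) ∣ (derivative A).eval z := by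
        have h1 : (derivative A).eval z * S.eval z = D.eval z := by
          simp only [hA, hD, derivative_sub, derivative_mul, derivative_C, eval_sub,
            eval_mul, eval_C, zero_mul, zero_add]
          linear_combination (derivative S).eval z * hz
        have h2 : (p : ℤ_[p]) ∣ D.eval z := by
          simpa using dvd_add (hev D z t₀ hzt ht₀) hDu
        rw [← h1] at h2
        exact (hS z hzt).dvd_mul_right.1 h2
      obtain ⟨k, hk⟩ := A.binomExpansion z x
      rw [← (hS _ (hzD x hx)).dvd_mul_right, hGA x hx, hk, hAz, zero_add]
      refine dvd_add (mul_dvd_mul hdA dvd_rfl) (Dvd.dvd.mul_left ?_ _)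
      rw [pow_two]
      exact mul_dvd_mul hx dvd_rfl)
  have hconj : ∀ n h, (fun h => G (z + h) - z)^[n] h = G^[n] (z + h) - z := by
    intro n
    induction n with
    | zero => intro h; simp
    | succ n ih => intro h; rw [Function.iterate_succ_apply, ih]; simp
  refine ⟨N, fun n x y hx hy hxy => ?_⟩
  have := hN n (x - z) (y - z) (by simpa using dvd_sub hx hzt) (by simpa using dvd_sub hy hzt)
    (by rw [hconj, hconj]; simpa using hxy)
  rw [hconj, hconj] at this
  simpa using this

end SuperAttracting

section Charts

open MvPolynomial in
lemma MvPolynomial.IsHomogeneous.map_mul_pow {σ S : Type*} [CommRing S]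
    (g ρ : MvPolynomial σ ℤ →+* S) (u : S) (h : ∀ l, g (X l) * u = ρ (X l))
    {a : MvPolynomial σ ℤ} {n : ℕ} (ha : a.IsHomogeneous n) : g a * u ^ n = ρ a := by
  rw [← support_sum_monomial_coeff a, map_sum, map_sum, Finset.sum_mul]
  refine Finset.sum_congr rfl fun m hm => ?_
  have hn : m.degree = n := by
    by_contra hne
    exact (mem_support_iff.1 hm) (ha.coeff_eq_zero hne)
  rw [monomial_eq, map_mul, map_mul, map_finsuppProd, map_finsuppProd, mul_assoc]
  congr 1
  · simp
  · rw [← hn, Finsupp.degree_apply, ← Finset.prod_pow_eq_pow_sum, Finsupp.prod, Finsupp.prod,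
      ← Finset.prod_mul_distrib]
    refine Finset.prod_congr rfl fun l _ => ?_
    rw [map_pow, map_pow, ← mul_pow, h]

lemma HomogeneousLocalization.Away.val_mk_mul {ι A σ : Type*} [CommRing A] [SetLike σ A]
    [AddSubgroupClass σ A] [AddCommMonoid ι] [DecidableEq ι] (𝒜 : ι → σ) [GradedRing 𝒜]
    {f : A} {d : ι} (hf : f ∈ 𝒜 d) (n : ℕ) (a : A) (ha : a ∈ 𝒜 (n • d)) :
    (HomogeneousLocalization.Away.mk 𝒜 hf n a ha).val *
      algebraMap A (Localization.Away f) f ^ n = algebraMap A (Localization.Away f) a := by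
  rw [HomogeneousLocalization.Away.val_mk, Localization.mk_eq_mk', ← map_pow]
  exact IsLocalization.mk'_spec (Localization.Away f) a ⟨f ^ n, pow_mem (Submonoid.mem_powers f) n⟩

open MvPolynomial in
/-- A ring of homogeneous fractions with denominators powers of one of the two variables is a
polynomial ring in the quotient of the variables. -/
lemma MvPolynomial.ringEquiv_polynomial_of_homogeneous_fractions {B L : Type*} [CommRing B]
    [CommRing L] [Algebra (MvPolynomial (Fin 2) ℤ) L] (i : Fin 2)
    [IsLocalization.Away (X i : MvPolynomial (Fin 2) ℤ) L] (v : B →+* L)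
    (hv : Function.Injective v) (t : B)
    (ht : v t * algebraMap (MvPolynomial (Fin 2) ℤ) L (X i) =
      algebraMap (MvPolynomial (Fin 2) ℤ) L (X i.rev))
    (hb : ∀ b, ∃ (n : ℕ) (a : MvPolynomial (Fin 2) ℤ), a.IsHomogeneous n ∧
      v b * algebraMap (MvPolynomial (Fin 2) ℤ) L (X i) ^ n =
        algebraMap (MvPolynomial (Fin 2) ℤ) L a) :
    Nonempty (B ≃+* Polynomial ℤ) := by
  have hk : i.rev ≠ i := (by decide : ∀ i : Fin 2, i.rev ≠ i) i
  have hl : ∀ l, l ≠ i → l = i.rev :=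
    fun l => (by decide : ∀ i l : Fin 2, l ≠ i → l = i.rev) i l
  obtain ⟨dh, hdhi, hdhk⟩ : ∃ dh : MvPolynomial (Fin 2) ℤ →+* Polynomial ℤ,
      dh (X i) = 1 ∧ dh (X i.rev) = Polynomial.X :=
    ⟨(aeval (fun l => if l = i then (1 : Polynomial ℤ) else Polynomial.X)).toRingHom,
      by simp, by simp [hk]⟩
  have hdh : IsUnit (dh (X i)) := by simp [hdhi]
  let ψ : B →+* Polynomial ℤ := (IsLocalization.Away.lift (S := L) (X i) hdh).comp v
  let θ : Polynomial ℤ →+* B := (Polynomial.aeval t).toRingHom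
  have hθ : θ Polynomial.X = t := by simp [θ]
  have hψt : ψ t = Polynomial.X := by
    have h2 := congrArg (IsLocalization.Away.lift (S := L) (X i) hdh) ht
    rwa [map_mul, IsLocalization.Away.lift_eq, IsLocalization.Away.lift_eq, hdhi, hdhk,
      mul_one] at h2
  have h1 : ψ.comp θ = RingHom.id _ := by
    refine Polynomial.ringHom_ext' (RingHom.ext_int _ _) ?_
    rw [RingHom.comp_apply, hθ, hψt, RingHom.id_apply]
  have hsurj : Function.Surjective θ := by
    intro b
    obtain ⟨n, a, ha, h⟩ := hb b
    refine ⟨dh a, hv ?_⟩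
    have h2 := MvPolynomial.IsHomogeneous.map_mul_pow (v.comp (θ.comp dh))
      (algebraMap (MvPolynomial (Fin 2) ℤ) L) (algebraMap (MvPolynomial (Fin 2) ℤ) L (X i)) (by
        intro l
        by_cases hl' : l = i
        · simp [hl', hdhi]
        · rw [hl l hl', RingHom.comp_apply, RingHom.comp_apply, hdhk, hθ, ht]) ha
    exact ((IsLocalization.Away.algebraMap_isUnit (S := L) (X i)).pow n).mul_right_cancel
      (h2.trans h.symm)
  exact ⟨(RingEquiv.ofBijective θ
    ⟨Function.LeftInverse.injective (g := ψ) (fun P => congrArg (fun g : _ →+* _ => g P) h1),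
      hsurj⟩).symm⟩

open MvPolynomial in
/-- A standard affine chart of `ℙ¹_ℤ` is an affine line. -/
lemma away_ringEquiv_polynomial (i : Fin 2) :
    Nonempty (HomogeneousLocalization.Away (homogeneousSubmodule (Fin 2) ℤ) (X i) ≃+*
      Polynomial ℤ) := by
  have hX : ∀ l, (X l : MvPolynomial (Fin 2) ℤ) ∈ homogeneousSubmodule (Fin 2) ℤ 1 := fun l =>
    (mem_homogeneousSubmodule 1 (X l)).2 (isHomogeneous_X ℤ l)
  have hX' : (X i.rev : MvPolynomial (Fin 2) ℤ) ∈ homogeneousSubmodule (Fin 2) ℤ (1 • 1) := hX _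
  refine MvPolynomial.ringEquiv_polynomial_of_homogeneous_fractions
    (L := Localization.Away (X i : MvPolynomial (Fin 2) ℤ)) i
    (algebraMap (HomogeneousLocalization.Away (homogeneousSubmodule (Fin 2) ℤ) (X i)) _)
    (HomogeneousLocalization.val_injective _)
    (HomogeneousLocalization.Away.mk (homogeneousSubmodule (Fin 2) ℤ) (hX i) 1 (X i.rev) hX') ?_
    fun b => ?_
  · have h := HomogeneousLocalization.Away.val_mk_mul (homogeneousSubmodule (Fin 2) ℤ)
      (hX i) 1 (X i.rev) hX'
    rwa [pow_one] at h
  · obtain ⟨n, a, ha, rfl⟩ := HomogeneousLocalization.Away.mk_surjective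
      (homogeneousSubmodule (Fin 2) ℤ) (hX i) b
    refine ⟨n, a, ?_, HomogeneousLocalization.Away.val_mk_mul _ (hX i) n a ha⟩
    rw [smul_eq_mul, mul_one] at ha
    exact (mem_homogeneousSubmodule n a).1 ha

open Polynomial in
lemma exists_chart_proj (i : Fin 2) :
    ∃ (ι : Spec (CommRingCat.of ℤ[X]) ⟶ Proj (MvPolynomial.homogeneousSubmodule (Fin 2) ℤ))
      (_ : IsOpenImmersion ι),
        ι.opensRange = Proj.basicOpen (MvPolynomial.homogeneousSubmodule (Fin 2) ℤ)
          (MvPolynomial.X i) := by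
  obtain ⟨e⟩ := away_ringEquiv_polynomial i
  have hX : (MvPolynomial.X i : MvPolynomial (Fin 2) ℤ) ∈
      MvPolynomial.homogeneousSubmodule (Fin 2) ℤ 1 :=
    (MvPolynomial.mem_homogeneousSubmodule 1 _).2 (MvPolynomial.isHomogeneous_X ℤ i)
  have h := Proj.opensRange_awayι (MvPolynomial.homogeneousSubmodule (Fin 2) ℤ)
    (MvPolynomial.X i) hX one_pos
  refine ⟨Spec.map e.toCommRingCatIso.hom ≫ Proj.awayι
    (MvPolynomial.homogeneousSubmodule (Fin 2) ℤ) (MvPolynomial.X i)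
    hX one_pos, inferInstance, ?_⟩
  rw [← h]
  exact Scheme.Hom.opensRange_comp_of_isIso _ _

open Polynomial in
/-- `ℙ¹_R` is covered by two affine lines. -/
lemma ProjOver.exists_charts (R : Type) [CommRing R] :
    ∃ j : Fin 2 → (Spec (CommRingCat.of R[X]) ⟶ ProjOver 1 R), (∀ i, IsOpenImmersion (j i)) ∧
      (∀ i, j i ≫ ProjOver.structMap 1 R = Spec.map (CommRingCat.ofHom C)) ∧
      ∀ x, ∃ i, x ∈ Set.range (j i) := by
  let 𝒜 := MvPolynomial.homogeneousSubmodule (Fin 2) ℤ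
  choose ι' hι' hr' using exists_chart_proj
  let ι : Fin 2 → (Spec (CommRingCat.of ℤ[X]) ⟶ ProjZ 1) := ι'
  have hι : ∀ i, IsOpenImmersion (ι i) := hι'
  let j : Fin 2 → (Spec (CommRingCat.of R[X]) ⟶ ProjOver 1 R) := fun i =>
    prod.lift (Spec.map (CommRingCat.ofHom (mapRingHom (Int.castRingHom R))) ≫ ι i)
      (Spec.map (CommRingCat.ofHom C))
  have hr : IsPullback (prod.snd : ProjOver 1 R ⟶ _) (prod.fst : ProjOver 1 R ⟶ ProjZ 1) 
      (specZIsTerminal.from _) (specZIsTerminal.from _) :=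
    (IsPullback.of_is_product' (prodIsProd _ _) specZIsTerminal).flip
  have hj : ∀ i, IsPullback (j i) (Spec.map (CommRingCat.ofHom (mapRingHom (Int.castRingHom R))))
      (prod.fst : ProjOver 1 R ⟶ ProjZ 1) (ι i) := by
    intro i
    refine IsPullback.of_right ?_ (prod.lift_fst _ _) hr
    have hs : (j i) ≫ (prod.snd : ProjOver 1 R ⟶ _) = Spec.map (CommRingCat.ofHom C) :=
      prod.lift_snd _ _
    rw [hs]
    let : Algebra ℤ[X] R[X] := (mapRingHom (Int.castRingHom R)).toAlgebra
    have : Algebra.IsPushout ℤ R ℤ[X] R[X] := inferInstance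
    have h := isPullback_SpecMap_of_isPushout _ _ _ _
      (CommRingCat.isPushout_of_isPushout ℤ R ℤ[X] R[X])
    convert h using 1
    all_goals exact specZIsTerminal.hom_ext _ _
  refine ⟨j, fun i => ?_, fun i => prod.lift_snd _ _, fun x => ?_⟩
  · exact MorphismProperty.of_isPullback (P := @IsOpenImmersion) (hj i).flip (hι i)
  · have hcov := Proj.iSup_basicOpen_eq_top' 𝒜 (fun i : Fin 2 => MvPolynomial.X i)
      (fun i => ⟨1, MvPolynomial.isHomogeneous_X ℤ i⟩) (by
        rw [eq_top_iff]
        rintro P -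
        induction P using MvPolynomial.induction_on with
        | C a => 
          exact Subalgebra.algebraMap_mem _ (⟨MvPolynomial.C a, MvPolynomial.isHomogeneous_C _ _⟩ : 𝒜 0)
        | add P Q hP hQ => exact add_mem hP hQ
        | mul_X P i hP => exact mul_mem hP (Algebra.subset_adjoin ⟨i, rfl⟩))
    have hx : (prod.fst : ProjOver 1 R ⟶ ProjZ 1) x ∈ (⊤ : (Proj 𝒜).Opens) := trivial
    rw [← hcov] at hx
    obtain ⟨i, hi⟩ := TopologicalSpace.Opens.mem_iSup.1 hx
    rw [← hr'] at hi
    obtain ⟨y, hy⟩ := hi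
    obtain ⟨w, hw, -⟩ := Scheme.exists_preimage_of_isPullback (hj i) x y hy.symm
    exact ⟨i, w, hw⟩

end Charts
section Sections

open Polynomial IsLocalRing

/-- The section of the affine line over `R` given by an element of `R`. -/
def lineSection {R : Type} [CommRing R] (t : R) :
    Spec (CommRingCat.of R) ⟶ Spec (CommRingCat.of R[X]) :=
  Spec.map (CommRingCat.ofHom (evalRingHom t))

lemma lineSection_injective {R : Type} [CommRing R] :
    Function.Injective (lineSection : R → _) := by
  intro t t' h
  have h2 := congrArg CommRingCat.Hom.hom (Spec.map_injective h)
  simpa using congrArg (fun g : R[X] →+* R => g X) h2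

lemma mem_lineSection_asIdeal {R : Type} [CommRing R] (t : R) (x : PrimeSpectrum R) (P : R[X]) :
    P ∈ (lineSection t x).asIdeal ↔ P.eval t ∈ x.asIdeal := Iff.rfl

lemma lineSection_bot_injective {R : Type} [CommRing R] [IsDomain R] :
    Function.Injective fun t : R => lineSection t (⊥ : PrimeSpectrum R) := by
  intro t t' h
  have h2 := mem_lineSection_asIdeal t ⊥ (X - C t)
  rw [show lineSection t (⊥ : PrimeSpectrum R) = lineSection t' (⊥ : PrimeSpectrum R) from h,
    mem_lineSection_asIdeal] at h2
  simpa [sub_eq_zero, eq_comm] using h2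

lemma lineSection_closedPoint_eq_iff {R : Type} [CommRing R] [IsLocalRing R] {t t' : R} :
    lineSection t (closedPoint R) = lineSection t' (closedPoint R) ↔
      t - t' ∈ maximalIdeal R := by
  constructor
  · intro h
    have h2 := mem_lineSection_asIdeal t (closedPoint R) (X - C t')
    rw [h, mem_lineSection_asIdeal] at h2
    have h3 : t - t' ∈ (closedPoint R).asIdeal := by
      simpa only [eval_sub, eval_X, eval_C, sub_self, zero_mem, true_iff] using h2
    exact h3
  · intro h
    refine PrimeSpectrum.ext (Ideal.ext fun P => ?_)
    rw [mem_lineSection_asIdeal, mem_lineSection_asIdeal]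
    have h2 : P.eval t - P.eval t' ∈ maximalIdeal R :=
      Ideal.mem_of_dvd _ (sub_dvd_eval_sub t t' P) h
    exact ⟨fun h3 => (Submodule.sub_mem_iff_right _ h3).1 h2,
      fun h3 => (Submodule.sub_mem_iff_left _ h3).1 h2⟩

/-- A section whose closed point lies in an affine line is a section of that affine line. -/
lemma exists_eq_lineSection_comp {R : Type} [CommRing R] [IsLocalRing R] {Y : Scheme}
    (s : Y ⟶ Spec (CommRingCat.of R)) (j : Spec (CommRingCat.of R[X]) ⟶ Y) [IsOpenImmersion j]
    (hj : j ≫ s = Spec.map (CommRingCat.ofHom C)) (a : Spec (CommRingCat.of R) ⟶ Y)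
    (ha : a ≫ s = 𝟙 _) (h : a (closedPoint R) ∈ Set.range j) :
    ∃ t, a = lineSection t ≫ j := by
  have hr : Set.range a ⊆ Set.range j := by
    have h2 : a ⁻¹ᵁ j.opensRange = ⊤ :=
      (IsLocalRing.closed_point_mem_iff (R := R)).1 h
    rintro _ ⟨x, rfl⟩
    have : x ∈ a ⁻¹ᵁ j.opensRange := h2 ▸ trivial
    exact this
  obtain ⟨ψ, hψ⟩ := Spec.map_surjective (IsOpenImmersion.lift j a hr)
  have hfac : Spec.map ψ ≫ j = a := by rw [hψ, IsOpenImmersion.lift_fac]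
  refine ⟨ψ.hom X, ?_⟩
  rw [← hfac]
  congr 2
  rw [← hfac, Category.assoc, hj, ← Spec.map_comp, ← Spec.map_id] at ha
  have h3 := congrArg CommRingCat.Hom.hom (Spec.map_injective ha)
  ext1
  refine Polynomial.ringHom_ext (fun r => ?_) ?_
  · simpa using congrArg (fun g : R →+* R => g r) h3
  · simp

/-- In an affine line, a morphism acts on a residue disc by a fraction of polynomials. -/
lemma exists_fraction_of_closedPoint_mem {R : Type} [CommRing R] [IsLocalRing R] {Y : Scheme}
    (s : Y ⟶ Spec (CommRingCat.of R)) (j : Spec (CommRingCat.of R[X]) ⟶ Y) [IsOpenImmersion j]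
    (hj : j ≫ s = Spec.map (CommRingCat.ofHom C)) (g : Y ⟶ Y) (hg : g ≫ s = s) (t₀ : R)
    (h : (lineSection t₀ ≫ j ≫ g) (closedPoint R) ∈ Set.range j) :
    ∃ Q S : R[X], ∀ t, t - t₀ ∈ maximalIdeal R → IsUnit (S.eval t) ∧
      ∃ y, lineSection t ≫ j ≫ g = lineSection y ≫ j ∧ y * S.eval t = Q.eval t := by
  obtain ⟨S, hS, hSU⟩ : ∃ S : R[X],
      lineSection t₀ (closedPoint R) ∈ PrimeSpectrum.basicOpen S ∧
        (PrimeSpectrum.basicOpen S : Set (PrimeSpectrum R[X])) ⊆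
          ((j ≫ g) ⁻¹ᵁ j.opensRange : Set (Spec (CommRingCat.of R[X]))) := by
    obtain ⟨_, ⟨S, rfl⟩, h1, h2⟩ :=
      PrimeSpectrum.isTopologicalBasis_basic_opens.exists_subset_of_mem_open
        (show lineSection t₀ (closedPoint R) ∈
          ((j ≫ g) ⁻¹ᵁ j.opensRange : Set (Spec (CommRingCat.of R[X]))) from h)
        ((j ≫ g) ⁻¹ᵁ j.opensRange).isOpen
    exact ⟨S, h1, h2⟩
  let L := Localization.Away S
  let ℓ : Spec (CommRingCat.of L) ⟶ Spec (CommRingCat.of R[X]) :=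
    Spec.map (CommRingCat.ofHom (algebraMap R[X] L))
  have hr : Set.range (ℓ ≫ j ≫ g) ⊆ Set.range j := by
    rintro _ ⟨x, rfl⟩
    have hx : ℓ x ∈ (PrimeSpectrum.basicOpen S : Set (PrimeSpectrum R[X])) := by
      rw [← PrimeSpectrum.localization_away_comap_range L S]
      exact ⟨x, rfl⟩
    exact hSU hx
  obtain ⟨ψ, hψ⟩ := Spec.map_surjective (IsOpenImmersion.lift j (ℓ ≫ j ≫ g) hr)
  have hfac : Spec.map ψ ≫ j = ℓ ≫ j ≫ g := by rw [hψ, IsOpenImmersion.lift_fac]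
  obtain ⟨k, Q, hQ⟩ := IsLocalization.Away.surj S (ψ.hom X)
  refine ⟨Q, S ^ k, fun t ht => ?_⟩
  have hc := lineSection_closedPoint_eq_iff.2 ht
  have hu : IsUnit (S.eval t) := by
    rw [← hc] at hS
    by_contra hn
    exact hS ((mem_lineSection_asIdeal t _ S).2 ((mem_maximalIdeal _).2 hn))
  refine ⟨by rw [eval_pow]; exact hu.pow k, ?_⟩
  obtain ⟨ε, hε'⟩ : ∃ ε : L →+* R, ε.comp (algebraMap R[X] L) = evalRingHom t :=
    ⟨IsLocalization.Away.lift (g := evalRingHom t) S hu, IsLocalization.Away.lift_comp S hu⟩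
  have hε'' : ∀ P, ε (algebraMap R[X] L P) = P.eval t := fun P =>
    congrArg (fun g : R[X] →+* R => g P) hε'
  have hε : lineSection t = Spec.map (CommRingCat.ofHom ε) ≫ ℓ := by
    rw [← Spec.map_comp, ← CommRingCat.ofHom_comp, hε']
    rfl
  obtain ⟨y, hy⟩ := exists_eq_lineSection_comp s j hj (lineSection t ≫ j ≫ g) (by
    rw [Category.assoc, Category.assoc, hg, hj, lineSection, ← Spec.map_comp,
      ← CommRingCat.ofHom_comp, ← Spec.map_id]
    congr 1
    ext r
    simp) (by
    change (j ≫ g) (lineSection t (closedPoint R)) ∈ _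
    rw [hc]
    exact h)
  refine ⟨y, hy, ?_⟩
  have h2 : Spec.map (ψ ≫ CommRingCat.ofHom ε) = lineSection y := by
    rw [← cancel_mono j, ← hy, hε, Spec.map_comp, Category.assoc, hfac, Category.assoc]
  have h3 := congrArg CommRingCat.Hom.hom (Spec.map_injective h2)
  have h4 : ε (ψ.hom X) = y := by
    simpa using congrArg (fun g : R[X] →+* R => g X) h3
  have h5 := congrArg ε hQ
  rw [map_mul, h4, ← map_pow] at h5
  rwa [← hε'', ← hε'']

end Sections

section Iterates

lemma Scheme.iter_add {X : Scheme} (f : X ⟶ X) (a b : ℕ) :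
    Scheme.iter f (a + b) = Scheme.iter f a ≫ Scheme.iter f b := by
  induction b with
  | zero => exact (Category.comp_id _).symm
  | succ b ih =>
    change Scheme.iter f (a + b) ≫ f = Scheme.iter f a ≫ Scheme.iter f b ≫ f
    rw [ih, Category.assoc]

lemma Scheme.iter_mul {X : Scheme} (f : X ⟶ X) (a b : ℕ) :
    Scheme.iter f (a * b) = Scheme.iter (Scheme.iter f a) b := by
  induction b with
  | zero => rfl
  | succ b ih =>
    rw [Nat.mul_succ, Scheme.iter_add, ih]
    rfl

lemma Scheme.iter_comp_eq {X S : Scheme} (f : X ⟶ X) (s : X ⟶ S) (h : f ≫ s = s) (n : ℕ) :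
    Scheme.iter f n ≫ s = s := by
  induction n with
  | zero => exact Category.id_comp s
  | succ n ih =>
    change (Scheme.iter f n ≫ f) ≫ s = s
    rw [Category.assoc, h, ih]

lemma Scheme.isFinite_iter {X : Scheme} (f : X ⟶ X) [IsFinite f] (n : ℕ) :
    IsFinite (Scheme.iter f n) := by
  induction n with
  | zero => exact inferInstanceAs (IsFinite (𝟙 X))
  | succ n ih => exact inferInstanceAs (IsFinite (Scheme.iter f n ≫ f))

lemma Scheme.iter_apply {X : Scheme} (f : X ⟶ X) (n : ℕ) (x : X) :
    Scheme.iter f n x = f^[n] x := by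
  induction n with
  | zero => rfl
  | succ n ih =>
    rw [Function.iterate_succ_apply', ← ih]
    rfl

lemma Scheme.comp_iter_eq_of_le {X T : Scheme} (f : X ⟶ X) {a b : T ⟶ X} {m n : ℕ} (h : m ≤ n)
    (hab : a ≫ Scheme.iter f m = b ≫ Scheme.iter f m) :
    a ≫ Scheme.iter f n = b ≫ Scheme.iter f n := by
  obtain ⟨k, rfl⟩ := Nat.exists_eq_add_of_le h
  rw [Scheme.iter_add, ← Category.assoc, hab, Category.assoc]

end Iterates

section PadicSections

open Polynomial IsLocalRing

variable {p : ℕ} [Fact p.Prime]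

lemma PadicInt.mem_maximalIdeal_iff_dvd {x : ℤ_[p]} :
    x ∈ maximalIdeal ℤ_[p] ↔ (p : ℤ_[p]) ∣ x := by
  rw [PadicInt.maximalIdeal_eq_span_p, Ideal.mem_span_singleton]

lemma finite_range_lineSection_closedPoint :
    (Set.range fun t : ℤ_[p] => lineSection t (closedPoint ℤ_[p])).Finite := by
  refine ((Finset.range p).finite_toSet.image
    fun n : ℕ => lineSection (n : ℤ_[p]) (closedPoint ℤ_[p])).subset ?_
  rintro _ ⟨t, rfl⟩
  obtain ⟨n, hn, h⟩ := PadicInt.exists_mem_range t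
  exact ⟨n, Finset.mem_coe.2 (Finset.mem_range.2 hn), (lineSection_closedPoint_eq_iff.2 h).symm⟩

/-- A finite morphism is not constant on the sections in a residue disc. -/
lemma not_forall_lineSection_comp_eq {Y : Scheme} (j : Spec (CommRingCat.of ℤ_[p][X]) ⟶ Y)
    [IsOpenImmersion j] (g : Y ⟶ Y) [IsFinite g] (t₀ : ℤ_[p])
    (a : Spec (CommRingCat.of ℤ_[p]) ⟶ Y)
    (h : ∀ t, (p : ℤ_[p]) ∣ t - t₀ → lineSection t ≫ j ≫ g = a) : False := by
  let η : PrimeSpectrum ℤ_[p] := ⊥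
  have hinj : Function.Injective fun u : ℤ_[p] => j (lineSection (t₀ + p * u) η) := by
    intro u v huv
    have h1 := lineSection_bot_injective (j.isOpenEmbedding.injective huv)
    have hp : (p : ℤ_[p]) ≠ 0 := Nat.cast_ne_zero.2 (Fact.out : p.Prime).ne_zero
    exact mul_left_cancel₀ hp (add_left_cancel h1)
  refine Set.infinite_range_of_injective hinj
    ((Scheme.Hom.finite_preimage_singleton g (a η)).subset ?_)
  rintro _ ⟨u, rfl⟩
  rw [Set.mem_preimage, Set.mem_singleton_iff, ← h (t₀ + p * u) ⟨u, by ring⟩]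
  rfl

/-- Cancellation for sections through a closed point fixed by a finite morphism. -/
lemma cancellation_of_fixed_closedPoint {Y : Scheme} (s : Y ⟶ Spec (CommRingCat.of ℤ_[p]))
    (j : Spec (CommRingCat.of ℤ_[p][X]) ⟶ Y) [IsOpenImmersion j]
    (hj : j ≫ s = Spec.map (CommRingCat.ofHom C)) (g : Y ⟶ Y) (hg : g ≫ s = s) [IsFinite g]
    (t₀ : ℤ_[p]) (c : Y) (hc : c = j (lineSection t₀ (closedPoint ℤ_[p]))) (hgc : g c = c) :
    ∃ N, ∀ (n : ℕ) (a b : Spec (CommRingCat.of ℤ_[p]) ⟶ Y), a ≫ s = 𝟙 _ → b ≫ s = 𝟙 _ →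
      a (closedPoint ℤ_[p]) = c → b (closedPoint ℤ_[p]) = c →
      a ≫ Scheme.iter g n = b ≫ Scheme.iter g n →
      a ≫ Scheme.iter g N = b ≫ Scheme.iter g N := by
  obtain ⟨Q, S, hQS⟩ := exists_fraction_of_closedPoint_mem s j hj g hg t₀ (by
    refine ⟨lineSection t₀ (closedPoint ℤ_[p]), ?_⟩
    rw [← hc]
    refine hgc.symm.trans ?_
    rw [hc]
    rfl)
  have hex : ∀ t, ∃ y, (p : ℤ_[p]) ∣ t - t₀ →
      lineSection t ≫ j ≫ g = lineSection y ≫ j ∧ y * S.eval t = Q.eval t := by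
    intro t
    by_cases ht : (p : ℤ_[p]) ∣ t - t₀
    · obtain ⟨-, y, hy⟩ := hQS t (PadicInt.mem_maximalIdeal_iff_dvd.2 ht)
      exact ⟨y, fun _ => hy⟩
    · exact ⟨0, fun h => absurd h ht⟩
  choose G hG using hex
  have hcl : ∀ t, (p : ℤ_[p]) ∣ t - t₀ ↔ j (lineSection t (closedPoint ℤ_[p])) = c := by
    intro t
    rw [hc, j.isOpenEmbedding.injective.eq_iff, lineSection_closedPoint_eq_iff,
      PadicInt.mem_maximalIdeal_iff_dvd]
  have hGd : ∀ t, (p : ℤ_[p]) ∣ t - t₀ → (p : ℤ_[p]) ∣ G t - t₀ := by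
    intro t ht
    rw [hcl]
    have h1 := congrArg (fun a : Spec (CommRingCat.of ℤ_[p]) ⟶ Y => a (closedPoint ℤ_[p]))
      (hG t ht).1
    refine h1.symm.trans ?_
    change g (j (lineSection t (closedPoint ℤ_[p]))) = c
    rw [(hcl t).1 ht, hgc]
  have hGn : ∀ n t, (p : ℤ_[p]) ∣ t - t₀ → (p : ℤ_[p]) ∣ G^[n] t - t₀ ∧
      (lineSection t ≫ j) ≫ Scheme.iter g n = lineSection (G^[n] t) ≫ j := by
    intro n t ht
    induction n with
    | zero => exact ⟨ht, Category.comp_id _⟩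
    | succ n ih =>
      rw [Function.iterate_succ_apply']
      refine ⟨hGd _ ih.1, ?_⟩
      change (lineSection t ≫ j) ≫ Scheme.iter g n ≫ g = _
      rw [← Category.assoc, ih.2, Category.assoc, (hG _ ih.1).1]
  obtain ⟨N, hN⟩ := rational_disc_cancellation Q S t₀ G
    (fun t ht => (hQS t (PadicInt.mem_maximalIdeal_iff_dvd.2 ht)).1)
    (fun t ht => ⟨hGd t ht, (hG t ht).2⟩) (by
      intro z hz
      refine not_forall_lineSection_comp_eq j g t₀ (lineSection z ≫ j) fun t ht => ?_
      have h1 := (hG t ht).2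
      rw [hz, eval_mul, eval_C] at h1
      rw [(hG t ht).1,
        (hQS t (PadicInt.mem_maximalIdeal_iff_dvd.2 ht)).1.mul_right_cancel h1])
  refine ⟨N, fun n a b ha hb hac hbc hab => ?_⟩
  obtain ⟨x, rfl⟩ := exists_eq_lineSection_comp s j hj a ha ⟨_, hc.symm.trans hac.symm⟩
  obtain ⟨y, rfl⟩ := exists_eq_lineSection_comp s j hj b hb ⟨_, hc.symm.trans hbc.symm⟩
  have hx := (hcl x).2 hac
  have hy := (hcl y).2 hbc
  rw [(hGn n x hx).2, (hGn n y hy).2, cancel_mono] at hab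
  rw [(hGn N x hx).2, (hGn N y hy).2, hN n x y hx hy (lineSection_injective hab)]

end PadicSections

theorem cancellation_on_P1_over_Zp
    (p : ℕ) [Fact p.Prime]
    (f : ProjOver 1 ℤ_[p] ⟶ ProjOver 1 ℤ_[p])
    (hfp : f ≫ ProjOver.structMap 1 ℤ_[p] = ProjOver.structMap 1 ℤ_[p])
    [IsFinite f] [AlgebraicGeometry.Surjective f] :
    ∃ N : ℕ, ∀ a b : Spec (CommRingCat.of ℤ_[p]) ⟶ ProjOver 1 ℤ_[p],
      a ≫ ProjOver.structMap 1 ℤ_[p] = 𝟙 _ →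
      b ≫ ProjOver.structMap 1 ℤ_[p] = 𝟙 _ →
      (∃ n : ℕ, a ≫ Scheme.iter f n = b ≫ Scheme.iter f n) →
      a ≫ Scheme.iter f N = b ≫ Scheme.iter f N := by
  obtain ⟨j, hopen, hj, hcov⟩ := ProjOver.exists_charts ℤ_[p]
  let s := ProjOver.structMap 1 ℤ_[p]
  let o : Spec (CommRingCat.of ℤ_[p]) := IsLocalRing.closedPoint ℤ_[p]
  let P : Set (ProjOver 1 ℤ_[p]) := ⋃ i, Set.range fun t : ℤ_[p] => j i (lineSection t o)
  have hP : P.Finite := Set.finite_iUnion fun i => by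
    have h := (finite_range_lineSection_closedPoint (p := p)).image (j i)
    rwa [← Set.range_comp] at h
  have hsec : ∀ a : Spec (CommRingCat.of ℤ_[p]) ⟶ ProjOver 1 ℤ_[p], a ≫ s = 𝟙 _ → a o ∈ P := by
    intro a ha
    obtain ⟨i, hi⟩ := hcov (a o)
    have := hopen i
    obtain ⟨t, rfl⟩ := exists_eq_lineSection_comp s (j i) (hj i) a ha hi
    exact Set.mem_iUnion.2 ⟨i, t, rfl⟩
  have hfP : ∀ c ∈ P, f c ∈ P := by
    intro c hc
    obtain ⟨i, t, rfl⟩ := Set.mem_iUnion.1 hc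
    refine hsec ((lineSection t ≫ j i) ≫ f) ?_
    rw [Category.assoc, Category.assoc, hfp, hj, lineSection, ← Spec.map_comp,
      ← CommRingCat.ofHom_comp, ← Spec.map_id]
    congr 1
    ext r
    simp
  have : Finite P := hP
  let φ : P → P := fun c => ⟨f c, hfP c c.2⟩
  have hφ : ∀ k c, (φ^[k] c : ProjOver 1 ℤ_[p]) = Scheme.iter f k c := by
    intro k c
    rw [Scheme.iter_apply]
    exact (Function.Semiconj.iterate_right (f := Subtype.val) (fun _ => rfl) k).eq c
  obtain ⟨m, hm, hidem⟩ := exists_iterate_idempotent φ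
  let g := Scheme.iter f m
  have hgs : g ≫ s = s := Scheme.iter_comp_eq f s hfp m
  have hgfin : IsFinite g := Scheme.isFinite_iter f m
  have hfix : ∀ c : P, ∃ N, g c = c →
      ∀ (n : ℕ) (a b : Spec (CommRingCat.of ℤ_[p]) ⟶ ProjOver 1 ℤ_[p]), a ≫ s = 𝟙 _ →
        b ≫ s = 𝟙 _ → a o = c → b o = c → a ≫ Scheme.iter g n = b ≫ Scheme.iter g n →
          a ≫ Scheme.iter g N = b ≫ Scheme.iter g N := by
    intro c
    by_cases hc : g c = c
    · obtain ⟨i, t, ht⟩ := Set.mem_iUnion.1 c.2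
      have := hopen i
      obtain ⟨N, hN⟩ := cancellation_of_fixed_closedPoint s (j i) (hj i) g hgs t c ht.symm hc
      exact ⟨N, fun _ => hN⟩
    · exact ⟨0, fun h => absurd h hc⟩
  choose N hN using hfix
  obtain ⟨M, hM⟩ := (Set.finite_range N).bddAbove
  refine ⟨m * (M + 1), fun a b ha hb ⟨n, hab⟩ => ?_⟩
  have hsplit : ∀ (k : ℕ) (a : Spec (CommRingCat.of ℤ_[p]) ⟶ ProjOver 1 ℤ_[p]),
      a ≫ Scheme.iter f (m * (k + 1)) = (a ≫ g) ≫ Scheme.iter g k := by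
    intro k a
    rw [Nat.mul_succ, add_comm, Scheme.iter_add, Scheme.iter_mul, Category.assoc]
  have hab' : a ≫ Scheme.iter f (m * (n + 1)) = b ≫ Scheme.iter f (m * (n + 1)) :=
    Scheme.comp_iter_eq_of_le f (by nlinarith) hab
  let c := φ^[m] ⟨a o, hsec a ha⟩
  have hac : (a ≫ g) o = c := (hφ m ⟨a o, hsec a ha⟩).symm
  have hbc : (b ≫ g) o = c := by
    have h1 : φ^[m * (n + 1)] ⟨a o, hsec a ha⟩ = φ^[m * (n + 1)] ⟨b o, hsec b hb⟩ := by
      refine Subtype.ext ?_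
      rw [hφ, hφ]
      exact congrArg (fun a : Spec (CommRingCat.of ℤ_[p]) ⟶ ProjOver 1 ℤ_[p] => a o) hab'
    rw [hidem _ n.succ_pos] at h1
    exact (hφ m ⟨b o, hsec b hb⟩).symm.trans (congrArg Subtype.val h1.symm)
  have hgc : g c = c := by
    rw [← hφ m c, ← Function.iterate_add_apply, ← two_mul, mul_comm, hidem 2 two_pos]
  rw [hsplit, hsplit] at hab' ⊢
  refine Scheme.comp_iter_eq_of_le g (hM ⟨c, rfl⟩) (hN c hgc n (a ≫ g) (b ≫ g) ?_ ?_ hac hbc hab')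
  · rw [Category.assoc, hgs, ha]
  · rw [Category.assoc, hgs, hb]

end
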